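/- arXiv:2209.04878 — 3 statements merged into one kernel-verified Lean document; each statement's English description precedes it below -/
import Mathlib

section
/- Let ℏ > 0, let H : ℝ² → ℝ be smooth, and let χ : ℝ × ℝ² → ℂ be smooth, satisfy the Koopman–van Hove equation iℏ ∂ₜχ = iℏ {H, χ} − (p ∂_p H − H) χ, and suppose there is a compact set K ⊆ ℝ² such that χ(t,z) = 0 for all t and all z ∉ K. Then the total energy is conserved: the function t ↦ Re ∫_{ℝ²} conj(χ(t,z)) · ( iℏ {H, χ(t,·)}(z) − (p ∂_p H(z) − H(z)) χ(t,z) ) dz is constant. -/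
open Complex MeasureTheory ComplexConjugate

/-- Partial derivative in `q` (first coordinate) of a complex-valued phase-space function. -/
noncomputable def dq (f : ℝ × ℝ → ℂ) (z : ℝ × ℝ) : ℂ :=
  deriv (fun q : ℝ => f (q, z.2)) z.1

/-- Partial derivative in `p` (second coordinate) of a complex-valued phase-space function. -/
noncomputable def dp (f : ℝ × ℝ → ℂ) (z : ℝ × ℝ) : ℂ :=
  deriv (fun p : ℝ => f (z.1, p)) z.2

/-- Partial derivative in `q` of a real-valued phase-space function. -/
noncomputable def dqR (f : ℝ × ℝ → ℝ) (z : ℝ × ℝ) : ℝ :=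
  deriv (fun q : ℝ => f (q, z.2)) z.1

/-- Partial derivative in `p` of a real-valued phase-space function. -/
noncomputable def dpR (f : ℝ × ℝ → ℝ) (z : ℝ × ℝ) : ℝ :=
  deriv (fun p : ℝ => f (z.1, p)) z.2

/-- Canonical Poisson bracket of a real function with a complex function:
`{H, f} = ∂_q H ∂_p f − ∂_p H ∂_q f`. -/
noncomputable def pb (H : ℝ × ℝ → ℝ) (f : ℝ × ℝ → ℂ) (z : ℝ × ℝ) : ℂ :=
  (dqR H z : ℂ) * dp f z - (dpR H z : ℂ) * dq f z

/-- Canonical Poisson bracket of two real functions. -/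
noncomputable def pbR (H f : ℝ × ℝ → ℝ) (z : ℝ × ℝ) : ℝ :=
  dqR H z * dpR f z - dpR H z * dqR f z

/-- Canonical Poisson bracket of two complex functions. -/
noncomputable def pbC (f g : ℝ × ℝ → ℂ) (z : ℝ × ℝ) : ℂ :=
  dq f z * dp g z - dp f z * dq g z

theorem dq_eq_fderiv {f : ℝ × ℝ → ℂ} {z : ℝ × ℝ} (hf : DifferentiableAt ℝ f z) :
    dq f z = fderiv ℝ f z (1, 0) :=
  (hf.hasFDerivAt.comp_hasDerivAt z.1
    ((hasDerivAt_id z.1).prodMk (hasDerivAt_const z.1 z.2))).deriv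

theorem dp_eq_fderiv {f : ℝ × ℝ → ℂ} {z : ℝ × ℝ} (hf : DifferentiableAt ℝ f z) :
    dp f z = fderiv ℝ f z (0, 1) :=
  (hf.hasFDerivAt.comp_hasDerivAt z.2
    ((hasDerivAt_const z.2 z.1).prodMk (hasDerivAt_id z.2))).deriv

theorem ofReal_dqR_eq_fderiv {H : ℝ × ℝ → ℝ} {z : ℝ × ℝ} (hH : DifferentiableAt ℝ H z) :
    (dqR H z : ℂ) = fderiv ℝ (fun w => (H w : ℂ)) z (1, 0) := by
  have h : HasDerivAt (fun q : ℝ => H (q, z.2)) (fderiv ℝ H z (1, 0)) z.1 :=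
    hH.hasFDerivAt.comp_hasDerivAt z.1 ((hasDerivAt_id z.1).prodMk (hasDerivAt_const z.1 z.2))
  have h' : HasFDerivAt (fun w => (H w : ℂ)) (ofRealCLM.comp (fderiv ℝ H z)) z :=
    ofRealCLM.hasFDerivAt.comp z hH.hasFDerivAt
  rw [dqR, h.deriv, h'.fderiv]
  rfl

theorem ofReal_dpR_eq_fderiv {H : ℝ × ℝ → ℝ} {z : ℝ × ℝ} (hH : DifferentiableAt ℝ H z) :
    (dpR H z : ℂ) = fderiv ℝ (fun w => (H w : ℂ)) z (0, 1) := by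
  have h : HasDerivAt (fun p : ℝ => H (z.1, p)) (fderiv ℝ H z (0, 1)) z.2 :=
    hH.hasFDerivAt.comp_hasDerivAt z.2 ((hasDerivAt_const z.2 z.1).prodMk (hasDerivAt_id z.2))
  have h' : HasFDerivAt (fun w => (H w : ℂ)) (ofRealCLM.comp (fderiv ℝ H z)) z :=
    ofRealCLM.hasFDerivAt.comp z hH.hasFDerivAt
  rw [dpR, h.deriv, h'.fderiv]
  rfl

/-- The Poisson bracket with a compactly supported function integrates to zero. -/
theorem integral_pb_eq_zero {H : ℝ × ℝ → ℝ} {u : ℝ × ℝ → ℂ} (hH : ContDiff ℝ 2 H)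
    (hu : ContDiff ℝ 1 u) (hu' : HasCompactSupport u) : ∫ z, pb H u z = 0 := by
  set h : ℝ × ℝ → ℂ := fun w => (H w : ℂ)
  have hc : ContDiff ℝ 2 h := ofRealCLM.contDiff.comp hH
  have hd : ContDiff ℝ 1 (fderiv ℝ h) := hc.fderiv_right (by norm_num)
  have hdv (v : ℝ × ℝ) : ContDiff ℝ 1 (fun z => fderiv ℝ h z v) := hd.clm_apply contDiff_const
  have hudiff := hu.differentiable one_ne_zero
  have hHdiff : Differentiable ℝ H := hH.differentiable two_ne_zero
  have huc (v : ℝ × ℝ) : Continuous (fun z => fderiv ℝ u z v) :=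
    (hu.continuous_fderiv one_ne_zero).clm_apply continuous_const
  have hsupp (v : ℝ × ℝ) : HasCompactSupport (fun z => fderiv ℝ u z v) := hu'.fderiv_apply ℝ v
  have hddc (v w : ℝ × ℝ) :
      Continuous (fun z => fderiv ℝ (fun y => fderiv ℝ h y v) z w) :=
    ((hdv v).continuous_fderiv one_ne_zero).clm_apply continuous_const
  have hint (v w : ℝ × ℝ) : Integrable (fun z => fderiv ℝ h z v * fderiv ℝ u z w) :=
    ((hdv v).continuous.mul (huc w)).integrable_of_hasCompactSupport (hsupp w).mul_left
  have parts (v w : ℝ × ℝ) : ∫ z, fderiv ℝ h z v * fderiv ℝ u z w =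
      - ∫ z, fderiv ℝ (fun y => fderiv ℝ h y v) z w * u z :=
    integral_mul_fderiv_eq_neg_fderiv_mul_of_integrable
      (((hddc v w).mul hu.continuous).integrable_of_hasCompactSupport hu'.mul_left)
      (hint v w)
      (((hdv v).continuous.mul hu.continuous).integrable_of_hasCompactSupport hu'.mul_left)
      (fun z _ => (hdv v).differentiable one_ne_zero z) (fun z _ => hudiff z)
  have hsymm (v w z : ℝ × ℝ) : fderiv ℝ (fun y => fderiv ℝ h y v) z w =
      fderiv ℝ (fun y => fderiv ℝ h y w) z v := by
    have hz : DifferentiableAt ℝ (fderiv ℝ h) z := hd.differentiable one_ne_zero z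
    have key (a b : ℝ × ℝ) : fderiv ℝ (fun y => fderiv ℝ h y a) z b =
        fderiv ℝ (fderiv ℝ h) z b a := by
      rw [fderiv_clm_apply hz (differentiableAt_const a)]
      simp
    rw [key, key]
    exact hc.contDiffAt.isSymmSndFDerivAt (by simp) w v
  have hpb : pb H u = fun z => fderiv ℝ h z (1, 0) * fderiv ℝ u z (0, 1) -
      fderiv ℝ h z (0, 1) * fderiv ℝ u z (1, 0) := by
    funext z
    rw [pb, dp_eq_fderiv (hudiff z), dq_eq_fderiv (hudiff z), ofReal_dqR_eq_fderiv (hHdiff z),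
      ofReal_dpR_eq_fderiv (hHdiff z)]
  rw [hpb, integral_sub (hint _ _) (hint _ _), parts, parts]
  simp_rw [hsymm (1, 0) (0, 1)]
  exact sub_self _

/-- The Leibniz rule for the Poisson bracket against a product `conj f * g`. -/
theorem pb_conj_mul (H : ℝ × ℝ → ℝ) {f g : ℝ × ℝ → ℂ} (hf : Differentiable ℝ f)
    (hg : Differentiable ℝ g) (z : ℝ × ℝ) :
    pb H (fun w => conj (f w) * g w) z = conj (pb H f z) * g z + conj (f z) * pb H g z := by
  have hfq : DifferentiableAt ℝ (fun q => f (q, z.2)) z.1 :=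
    (hf z).comp z.1 (differentiableAt_id.prodMk (differentiableAt_const _))
  have hfp : DifferentiableAt ℝ (fun p => f (z.1, p)) z.2 :=
    (hf z).comp z.2 ((differentiableAt_const _).prodMk differentiableAt_id)
  have hgq : DifferentiableAt ℝ (fun q => g (q, z.2)) z.1 :=
    (hg z).comp z.1 (differentiableAt_id.prodMk (differentiableAt_const _))
  have hgp : DifferentiableAt ℝ (fun p => g (z.1, p)) z.2 :=
    (hg z).comp z.2 ((differentiableAt_const _).prodMk differentiableAt_id)
  have hq : dq (fun w => conj (f w) * g w) z = conj (dq f z) * g z + conj (f z) * dq g z :=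
    (hfq.hasDerivAt.star.mul hgq.hasDerivAt).deriv
  have hp : dp (fun w => conj (f w) * g w) z = conj (dp f z) * g z + conj (f z) * dp g z :=
    (hfp.hasDerivAt.star.mul hgp.hasDerivAt).deriv
  simp only [pb, hq, hp, map_sub, map_mul, conj_ofReal]
  ring

/-- Differentiation under the integral sign for a family supported in a fixed compact set. -/
theorem hasDerivAt_integral_of_compact_support {F F' : ℝ → ℝ × ℝ → ℂ} {K : Set (ℝ × ℝ)}
    (hK : IsCompact K) (hF : ∀ t, Continuous (F t))
    (hF' : Continuous (fun x : ℝ × (ℝ × ℝ) => F' x.1 x.2))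
    (hderiv : ∀ t z, HasDerivAt (fun s => F s z) (F' t z) t)
    (hsupp : ∀ t, ∀ z ∉ K, F t z = 0) (t : ℝ) :
    HasDerivAt (fun s => ∫ z, F s z) (∫ z, F' t z) t := by
  have hsupp' (s : ℝ) (z : ℝ × ℝ) (hz : z ∉ K) : F' s z = 0 := by
    have h0 : (fun r => F r z) = fun _ => 0 := funext fun r => hsupp r z hz
    exact (h0 ▸ hderiv s z).unique (hasDerivAt_const s 0)
  obtain ⟨C, hC⟩ := ((isCompact_closedBall t 1).prod hK).exists_bound_of_continuousOn
    hF'.continuousOn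
  refine (hasDerivAt_integral_of_dominated_loc_of_deriv_le (bound := K.indicator fun _ => C)
    (Metric.closedBall_mem_nhds t one_pos) (.of_forall fun s => (hF s).aestronglyMeasurable)
    ((hF t).integrable_of_hasCompactSupport (HasCompactSupport.intro hK (hsupp t)))
    (hF'.comp (Continuous.prodMk_right t)).aestronglyMeasurable
    (.of_forall fun z s hs => ?_) ?_ (.of_forall fun z s _ => hderiv s z)).2
  · by_cases hz : z ∈ K
    · simpa [hz] using hC (s, z) ⟨hs, hz⟩
    · simp [hz, hsupp' s z hz]
  · exact (integrableOn_const hK.measure_lt_top.ne).integrable_indicator hK.measurableSet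

/-- The total energy of a compactly supported smooth solution of the
Koopman–van Hove equation is conserved in time. -/
theorem kvh_energy_conservation (ℏ : ℝ) (hℏ : 0 < ℏ)
    (H : ℝ × ℝ → ℝ) (hH : ContDiff ℝ (⊤ : ℕ∞) H)
    (χ : ℝ → ℝ × ℝ → ℂ)
    (hχ : ContDiff ℝ (⊤ : ℕ∞) (fun tz : ℝ × (ℝ × ℝ) => χ tz.1 tz.2))
    (hKvH : ∀ (t : ℝ) (z : ℝ × ℝ),
      Complex.I * (ℏ : ℂ) * deriv (fun s => χ s z) t
        = Complex.I * (ℏ : ℂ) * pb H (χ t) z - ((z.2 * dpR H z - H z : ℝ) : ℂ) * χ t z)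
    (K : Set (ℝ × ℝ)) (hK : IsCompact K)
    (hsupp : ∀ (t : ℝ) (z : ℝ × ℝ), z ∉ K → χ t z = 0) :
    ∀ t₁ t₂ : ℝ,
      (∫ z : ℝ × ℝ, conj (χ t₁ z) * (Complex.I * (ℏ : ℂ) * pb H (χ t₁) z
          - ((z.2 * dpR H z - H z : ℝ) : ℂ) * χ t₁ z)).re
      = (∫ z : ℝ × ℝ, conj (χ t₂ z) * (Complex.I * (ℏ : ℂ) * pb H (χ t₂) z
          - ((z.2 * dpR H z - H z : ℝ) : ℂ) * χ t₂ z)).re := by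
  have h1 : ContDiff ℝ 1 (fun x : ℝ × (ℝ × ℝ) => χ x.1 x.2) := hχ.of_le (by exact_mod_cast le_top)
  have hH2 : ContDiff ℝ 2 H := mod_cast contDiff_infty.mp hH 2
  have hz1 (t : ℝ) : ContDiff ℝ 1 (χ t) := h1.comp (contDiff_const.prodMk contDiff_id)
  have hzd (t : ℝ) : Differentiable ℝ (χ t) := (hz1 t).differentiable one_ne_zero
  set χ' : ℝ → ℝ × ℝ → ℂ := fun t z => deriv (fun s => χ s z) t
  have hd (t : ℝ) (z : ℝ × ℝ) : HasDerivAt (fun s => χ s z) (χ' t z) t :=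
    ((h1.comp (contDiff_id.prodMk contDiff_const)).differentiable one_ne_zero t).hasDerivAt
  have hcont' : Continuous (fun x : ℝ × (ℝ × ℝ) => χ' x.1 x.2) := by
    have h : (fun x : ℝ × (ℝ × ℝ) => χ' x.1 x.2) =
        fun x => fderiv ℝ (fun y : ℝ × (ℝ × ℝ) => χ y.1 y.2) x (1, 0) := by
      funext x
      exact ((h1.differentiable one_ne_zero x).hasFDerivAt.comp_hasDerivAt x.1
        ((hasDerivAt_id x.1).prodMk (hasDerivAt_const x.1 x.2))).deriv
    rw [h]
    exact (h1.continuous_fderiv one_ne_zero).clm_apply continuous_const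
  have hev (t : ℝ) (z : ℝ × ℝ) : χ' t z =
      pb H (χ t) z + I * (((z.2 * dpR H z - H z) / ℏ : ℝ) : ℂ) * χ t z := by
    have hne : (ℏ : ℂ) ≠ 0 := by exact_mod_cast hℏ.ne'
    refine mul_left_cancel₀ (mul_ne_zero I_ne_zero hne) ((hKvH t z).trans ?_)
    rw [ofReal_div]
    generalize ((z.2 * dpR H z - H z : ℝ) : ℂ) = L
    field_simp
    linear_combination (-L * χ t z) * I_sq
  -- The overlap of the solution with its own time translate is independent of time.
  have hoverlap (τ : ℝ) (t : ℝ) :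
      HasDerivAt (fun s => ∫ z, conj (χ s z) * χ (s + τ) z) 0 t := by
    have hzero : ∫ z, (conj (χ' t z) * χ (t + τ) z + conj (χ t z) * χ' (t + τ) z) = 0 := by
      rw [← integral_pb_eq_zero hH2 (u := fun z => conj (χ t z) * χ (t + τ) z)
        ((conjCLE.contDiff.comp (hz1 t)).mul (hz1 (t + τ)))
        (HasCompactSupport.intro hK fun z hz => by simp [hsupp t z hz])]
      congr 1
      funext z
      rw [pb_conj_mul H (hzd t) (hzd (t + τ)), hev, hev]
      simp only [map_add, map_mul, conj_I, conj_ofReal]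
      ring
    rw [← hzero]
    refine hasDerivAt_integral_of_compact_support hK
      (F' := fun s z => conj (χ' s z) * χ (s + τ) z + conj (χ s z) * χ' (s + τ) z)
      (fun s => (continuous_conj.comp (hz1 s).continuous).mul (hz1 (s + τ)).continuous) ?_
      (fun s z => (hd s z).star.mul ((hd (s + τ) z).comp_add_const s τ))
      (fun s z hz => by simp [hsupp s z hz]) t
    have hshift : Continuous (fun x : ℝ × (ℝ × ℝ) => (x.1 + τ, x.2)) := by fun_prop
    exact ((continuous_conj.comp hcont').mul (h1.continuous.comp hshift)).add
      ((continuous_conj.comp h1.continuous).mul (hcont'.comp hshift))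
  have hconst (τ s t : ℝ) :
      ∫ z, conj (χ s z) * χ (s + τ) z = ∫ z, conj (χ t z) * χ (t + τ) z :=
    is_const_of_deriv_eq_zero (fun r => (hoverlap τ r).differentiableAt)
      (fun r => (hoverlap τ r).deriv) s t
  have hrate (t : ℝ) : HasDerivAt (fun τ => ∫ z, conj (χ t z) * χ (t + τ) z)
      (∫ z, conj (χ t z) * χ' t z) 0 := by
    have hshift : Continuous (fun x : ℝ × (ℝ × ℝ) => (t + x.1, x.2)) := by fun_prop
    simpa using hasDerivAt_integral_of_compact_support hK
      (F := fun τ z => conj (χ t z) * χ (t + τ) z)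
      (F' := fun τ z => conj (χ t z) * χ' (t + τ) z)
      (fun τ => (continuous_conj.comp (hz1 t).continuous).mul (hz1 (t + τ)).continuous)
      ((continuous_conj.comp ((hz1 t).continuous.comp continuous_snd)).mul (hcont'.comp hshift))
      (fun τ z => ((hd (t + τ) z).comp_const_add t τ).const_mul _)
      (fun τ z hz => by simp [hsupp t z hz]) 0
  have henergy (t : ℝ) : ∫ z : ℝ × ℝ, conj (χ t z) * (I * (ℏ : ℂ) * pb H (χ t) z
      - ((z.2 * dpR H z - H z : ℝ) : ℂ) * χ t z) =
      I * (ℏ : ℂ) * ∫ z, conj (χ t z) * χ' t z := by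
    rw [← integral_const_mul]
    congr 1
    funext z
    rw [← hKvH t z]
    ring
  intro t₁ t₂
  rw [henergy, henergy]
  congr 2
  refine (hrate t₁).unique ?_
  simpa only [hconst _ t₁ t₂] using hrate t₂
end

section
/- Let ℏ > 0, let n ∈ ℕ, let Ĥ : ℝ² → Matrix (Fin n) (Fin n) ℂ be smooth with Ĥ(z) Hermitian for every z, and let Υ : ℝ × ℝ² → ℂⁿ be smooth, satisfy the quantum–classical wave equation iℏ ∂ₜΥ = iℏ ( ∂_q Ĥ · ∂_p Υ − ∂_p Ĥ · ∂_q Υ ) − ( p ∂_p Ĥ − Ĥ ) Υ, and suppose there is a compact set K ⊆ ℝ² with Υ(t,z) = 0 for all t and all z ∉ K. Then the hybrid L² norm is conserved: t ↦ ∫_{ℝ²} ‖Υ(t,z)‖² dz is constant. -/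
open Complex MeasureTheory ComplexConjugate Matrix

/-- Partial derivative in `q` of a matrix-valued phase-space function (entrywise). -/
noncomputable def dqM {n : ℕ} (A : ℝ × ℝ → Matrix (Fin n) (Fin n) ℂ) (z : ℝ × ℝ) :
    Matrix (Fin n) (Fin n) ℂ :=
  fun i j => deriv (fun q : ℝ => A (q, z.2) i j) z.1

/-- Partial derivative in `p` of a matrix-valued phase-space function (entrywise). -/
noncomputable def dpM {n : ℕ} (A : ℝ × ℝ → Matrix (Fin n) (Fin n) ℂ) (z : ℝ × ℝ) :
    Matrix (Fin n) (Fin n) ℂ :=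
  fun i j => deriv (fun p : ℝ => A (z.1, p) i j) z.2

/-- Partial derivative in `q` of a vector-valued phase-space function (componentwise). -/
noncomputable def dqV {n : ℕ} (f : ℝ × ℝ → Fin n → ℂ) (z : ℝ × ℝ) : Fin n → ℂ :=
  fun i => deriv (fun q : ℝ => f (q, z.2) i) z.1

/-- Partial derivative in `p` of a vector-valued phase-space function (componentwise). -/
noncomputable def dpV {n : ℕ} (f : ℝ × ℝ → Fin n → ℂ) (z : ℝ × ℝ) : Fin n → ℂ :=
  fun i => deriv (fun p : ℝ => f (z.1, p) i) z.2

/-- The hybrid Liouvillian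
`(L Υ)(z) = iℏ (∂_q Ĥ · ∂_p Υ − ∂_p Ĥ · ∂_q Υ) − (p ∂_p Ĥ − Ĥ) · Υ(z)`. -/
noncomputable def hybridLiouvillian {n : ℕ} (ℏ : ℝ)
    (A : ℝ × ℝ → Matrix (Fin n) (Fin n) ℂ) (Υ : ℝ × ℝ → Fin n → ℂ) (z : ℝ × ℝ) :
    Fin n → ℂ :=
  fun i => Complex.I * (ℏ : ℂ) *
      ((dqM A z).mulVec (dpV Υ z) i - (dpM A z).mulVec (dqV Υ z) i)
    - ((z.2 : ℂ) • dpM A z - A z).mulVec (Υ z) i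

theorem integral_fderiv_apply_eq_zero {u : ℝ × ℝ → ℂ} (hu : ContDiff ℝ 1 u)
    (hc : HasCompactSupport u) (v : ℝ × ℝ) : ∫ z, fderiv ℝ u z v = 0 := by
  have hd : Continuous fun z => fderiv ℝ u z v :=
    (hu.continuous_fderiv one_ne_zero).clm_apply continuous_const
  have h := integral_mul_fderiv_eq_neg_fderiv_mul_of_integrable (𝕜 := ℂ)
    (μ := (volume : Measure (ℝ × ℝ))) (f := fun _ => (1 : ℂ)) (g := u) (v := v)
    (by simp) (by simpa using hd.integrable_of_hasCompactSupport (hc.fderiv_apply ℝ v))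
    (by simpa using hu.continuous.integrable_of_hasCompactSupport hc)
    (by simp) (fun x _ => hu.differentiable one_ne_zero x)
  simpa using h

theorem hasDerivAt_integral_of_support_subset_compact {G : ℝ → ℝ × ℝ → ℂ}
    (hG : ContDiff ℝ 1 (fun x : ℝ × (ℝ × ℝ) => G x.1 x.2))
    {K : Set (ℝ × ℝ)} (hK : IsCompact K) (h0 : ∀ t, ∀ z ∉ K, G t z = 0) (t : ℝ) :
    HasDerivAt (fun s => ∫ z, G s z) (∫ z, deriv (fun s => G s z) t) t := by
  have hder (s : ℝ) (z : ℝ × ℝ) : HasDerivAt (fun s => G s z)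
      (fderiv ℝ (fun x : ℝ × (ℝ × ℝ) => G x.1 x.2) (s, z) (1, 0)) s := by
    have h1 : HasFDerivAt (fun x : ℝ × (ℝ × ℝ) => G x.1 x.2) _ (s, z) :=
      (hG.differentiable one_ne_zero (s, z)).hasFDerivAt
    exact h1.comp_hasDerivAt s ((hasDerivAt_id s).prodMk (hasDerivAt_const s z))
  have hcont : Continuous fun x : ℝ × (ℝ × ℝ) => deriv (fun s => G s x.2) x.1 := by
    have : (fun x : ℝ × (ℝ × ℝ) => deriv (fun s => G s x.2) x.1) =
        fun x => fderiv ℝ (fun x : ℝ × (ℝ × ℝ) => G x.1 x.2) x (1, 0) :=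
      funext fun x => (hder x.1 x.2).deriv
    rw [this]
    exact (hG.continuous_fderiv one_ne_zero).clm_apply continuous_const
  have hslice (s : ℝ) : Continuous (G s) := hG.continuous.comp (by fun_prop : Continuous (Prod.mk s))
  have hslice' : Continuous fun z => deriv (fun s => G s z) t :=
    hcont.comp (by fun_prop : Continuous (Prod.mk t))
  obtain ⟨C, hC⟩ := ((isCompact_closedBall t 1).prod hK).exists_bound_of_continuousOn
    hcont.continuousOn
  refine (hasDerivAt_integral_of_dominated_loc_of_deriv_le (μ := volume)
    (F' := fun s z => deriv (fun s => G s z) s) (bound := K.indicator fun _ => C)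
    (Metric.closedBall_mem_nhds t one_pos)
    (.of_forall fun s => (hslice s).aestronglyMeasurable)
    ((hslice t).integrable_of_hasCompactSupport (.intro hK (h0 t)))
    hslice'.aestronglyMeasurable
    (.of_forall fun z s hs => ?_) ?_
    (.of_forall fun z s _ => (hder s z).differentiableAt.hasDerivAt)).2
  · by_cases hz : z ∈ K
    · simpa [hz] using hC (s, z) ⟨hs, hz⟩
    · simp [hz, h0 _ z hz]
  · exact (integrable_indicator_iff hK.measurableSet).2
      (integrableOn_const hK.measure_lt_top.ne)

theorem deriv_slice_fst {u : ℝ × ℝ → ℂ} {z : ℝ × ℝ} (hu : DifferentiableAt ℝ u z) :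
    deriv (fun q => u (q, z.2)) z.1 = fderiv ℝ u z (1, 0) :=
  (HasFDerivAt.comp_hasDerivAt z.1 (f := fun q => (q, z.2)) hu.hasFDerivAt
    ((hasDerivAt_id z.1).prodMk (hasDerivAt_const z.1 z.2))).deriv

theorem deriv_slice_snd {u : ℝ × ℝ → ℂ} {z : ℝ × ℝ} (hu : DifferentiableAt ℝ u z) :
    deriv (fun p => u (z.1, p)) z.2 = fderiv ℝ u z (0, 1) :=
  (HasFDerivAt.comp_hasDerivAt z.2 (f := fun p => (z.1, p)) hu.hasFDerivAt
    ((hasDerivAt_const z.2 z.1).prodMk (hasDerivAt_id z.2))).deriv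

theorem fderiv_star_apply {u : ℝ × ℝ → ℂ} (z v : ℝ × ℝ) :
    fderiv ℝ (fun w => conj (u w)) z v = conj (fderiv ℝ u z v) := by
  have : fderiv ℝ (fun w => conj (u w)) z = _ := Complex.conjCLE.comp_fderiv (f := u) (x := z)
  rw [this]; rfl

theorem sum_conj_mulVec_mul {n : ℕ} {B : Matrix (Fin n) (Fin n) ℂ} (hB : B.IsHermitian)
    (x y : Fin n → ℂ) :
    ∑ i, conj (B.mulVec x i) * y i = ∑ i, conj (x i) * B.mulVec y i := by
  simp only [mulVec, dotProduct, map_sum, map_mul, Finset.sum_mul, Finset.mul_sum]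
  rw [Finset.sum_comm]
  refine Finset.sum_congr rfl fun i _ => Finset.sum_congr rfl fun j _ => ?_
  have := hB.apply i j
  rw [starRingEnd_apply, this]; ring

theorem fderiv_hermitian_form {n : ℕ} {B : ℝ × ℝ → Matrix (Fin n) (Fin n) ℂ}
    {y : ℝ × ℝ → Fin n → ℂ} {z : ℝ × ℝ}
    (hB : ∀ i j, DifferentiableAt ℝ (fun w => B w i j) z)
    (hy : ∀ i, DifferentiableAt ℝ (fun w => y w i) z) (v : ℝ × ℝ) :
    fderiv ℝ (fun w => ∑ i, conj (y w i) * (B w).mulVec (y w) i) z v =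
      ∑ i, conj (fderiv ℝ (fun w => y w i) z v) * (B z).mulVec (y z) i
      + ∑ i, conj (y z i) *
        (Matrix.of fun i j => fderiv ℝ (fun w => B w i j) z v).mulVec (y z) i
      + ∑ i, conj (y z i) * (B z).mulVec (fun j => fderiv ℝ (fun w => y w j) z v) i := by
  have hy' (i) : DifferentiableAt ℝ (fun w => conj (y w i)) z :=
    Complex.conjCLE.differentiableAt.comp z (hy i)
  have hBy (i) : DifferentiableAt ℝ (fun w => (B w).mulVec (y w) i) z := by
    simp only [mulVec, dotProduct]
    exact .fun_sum fun j _ => (hB i j).mul (hy j)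
  rw [fderiv_fun_sum fun i _ => (hy' i).fun_mul (hBy i), _root_.sum_apply,
    ← Finset.sum_add_distrib, ← Finset.sum_add_distrib]
  refine Finset.sum_congr rfl fun i _ => ?_
  rw [fderiv_fun_mul (hy' i) (hBy i)]
  simp only [mulVec, dotProduct, Matrix.of_apply]
  rw [fderiv_fun_sum fun j _ => (hB i j).fun_mul (hy j)]
  simp only [_root_.add_apply, _root_.smul_apply, smul_eq_mul,
    _root_.sum_apply, fderiv_star_apply]
  have h (j) := fderiv_fun_mul (hB i j) (hy j)
  simp only [h, _root_.add_apply, _root_.smul_apply, smul_eq_mul,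
    Finset.sum_add_distrib, mul_comm (y z _)]
  ring

theorem isHermitian_fderiv_apply {n : ℕ} {A : ℝ × ℝ → Matrix (Fin n) (Fin n) ℂ}
    (hAh : ∀ z, (A z).IsHermitian) (z v : ℝ × ℝ) :
    (Matrix.of fun i j => fderiv ℝ (fun w => A w i j) z v).IsHermitian := by
  ext i j
  have : (fun w => A w i j) = fun w => conj (A w j i) :=
    funext fun w => ((hAh w).apply i j).symm
  simp only [conjTranspose_apply, Matrix.of_apply]
  rw [this, fderiv_star_apply]; rfl

theorem fderiv_fderiv_apply_comm {u : ℝ × ℝ → ℂ} (hu : ContDiff ℝ 2 u) (z v w : ℝ × ℝ) :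
    fderiv ℝ (fun x => fderiv ℝ u x v) z w = fderiv ℝ (fun x => fderiv ℝ u x w) z v := by
  have hd : DifferentiableAt ℝ (fderiv ℝ u) z :=
    (hu.fderiv_right (m := 1) (by norm_num)).differentiable one_ne_zero z
  rw [fderiv_clm_apply hd (by fun_prop), fderiv_clm_apply hd (by fun_prop)]
  simpa using (hu.contDiffAt.isSymmSndFDerivAt (by simp)).eq w v

theorem sum_conj_mul_evolution {n : ℕ} {ℏ : ℝ} (hℏ : ℏ ≠ 0) {B C M : Matrix (Fin n) (Fin n) ℂ}
    (hB : B.IsHermitian) (hC : C.IsHermitian) (hM : M.IsHermitian) {y yq yp yt : Fin n → ℂ}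
    (h : ∀ i, Complex.I * (ℏ : ℂ) * yt i =
      Complex.I * (ℏ : ℂ) * (B.mulVec yp i - C.mulVec yq i) - M.mulVec y i) :
    ∑ i, (conj (yt i) * y i + conj (y i) * yt i) =
      (∑ i, conj (yp i) * B.mulVec y i + ∑ i, conj (y i) * B.mulVec yp i)
      - (∑ i, conj (yq i) * C.mulVec y i + ∑ i, conj (y i) * C.mulVec yq i) := by
  have hℏ' : (ℏ : ℂ) ≠ 0 := Complex.ofReal_ne_zero.2 hℏ
  have hyt (i) : yt i = B.mulVec yp i - C.mulVec yq i + Complex.I * (ℏ : ℂ)⁻¹ * M.mulVec y i := by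
    refine mul_left_cancel₀ (mul_ne_zero Complex.I_ne_zero hℏ') ((h i).trans ?_)
    have : Complex.I * (ℏ : ℂ) * (Complex.I * (ℏ : ℂ)⁻¹) = -1 := by
      field_simp
      exact Complex.I_sq
    linear_combination (-M.mulVec y i) * this
  have hterm (i) : conj (yt i) * y i + conj (y i) * yt i =
      (conj (B.mulVec yp i) * y i + conj (y i) * B.mulVec yp i)
      - (conj (C.mulVec yq i) * y i + conj (y i) * C.mulVec yq i)
      - Complex.I * (ℏ : ℂ)⁻¹ * (conj (M.mulVec y i) * y i)
      + Complex.I * (ℏ : ℂ)⁻¹ * (conj (y i) * M.mulVec y i) := by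
    simp only [hyt, map_add, map_sub, map_mul, map_inv₀, Complex.conj_I, Complex.conj_ofReal]
    ring
  simp only [hterm, Finset.sum_add_distrib, Finset.sum_sub_distrib, ← Finset.mul_sum,
    sum_conj_mulVec_mul hB, sum_conj_mulVec_mul hC, sum_conj_mulVec_mul hM]
  ring

theorem contDiff_hermitian_form {n : ℕ} {B : ℝ × ℝ → Matrix (Fin n) (Fin n) ℂ}
    {y : ℝ × ℝ → Fin n → ℂ} (hB : ∀ i j, ContDiff ℝ 1 fun w => B w i j)
    (hy : ∀ i, ContDiff ℝ 1 fun w => y w i) :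
    ContDiff ℝ 1 fun w => ∑ i, conj (y w i) * (B w).mulVec (y w) i := by
  simp only [mulVec, dotProduct]
  exact .sum fun i _ => (Complex.conjCLE.contDiff.comp (hy i)).mul
    (.sum fun j _ => (hB i j).mul (hy j))

/-- The hybrid `L²` norm of a smooth solution of the
quantum–classical wave equation, vanishing outside a compact set in phase space,
is conserved in time. -/
theorem qcwe_norm_conservation {n : ℕ} (ℏ : ℝ) (hℏ : 0 < ℏ)
    (A : ℝ × ℝ → Matrix (Fin n) (Fin n) ℂ)
    (hA : ∀ i j, ContDiff ℝ (⊤ : ℕ∞) (fun z : ℝ × ℝ => A z i j))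
    (hAh : ∀ z, (A z).IsHermitian)
    (Υ : ℝ → ℝ × ℝ → Fin n → ℂ)
    (hΥ : ContDiff ℝ (⊤ : ℕ∞) (fun tz : ℝ × (ℝ × ℝ) => Υ tz.1 tz.2))
    (hQCWE : ∀ (t : ℝ) (z : ℝ × ℝ) (i : Fin n),
      Complex.I * (ℏ : ℂ) * deriv (fun s => Υ s z i) t
        = hybridLiouvillian ℏ A (Υ t) z i)
    (K : Set (ℝ × ℝ)) (hK : IsCompact K)
    (hsupp : ∀ (t : ℝ) (z : ℝ × ℝ), z ∉ K → Υ t z = 0) :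
    ∀ t₁ t₂ : ℝ,
      ∫ z : ℝ × ℝ, ∑ i, Complex.normSq (Υ t₁ z i)
        = ∫ z : ℝ × ℝ, ∑ i, Complex.normSq (Υ t₂ z i) := by
  have hΥi (i : Fin n) : ContDiff ℝ (⊤ : ℕ∞) fun x : ℝ × (ℝ × ℝ) => Υ x.1 x.2 i :=
    contDiff_pi.1 hΥ i
  have hY (t : ℝ) (i : Fin n) : ContDiff ℝ (⊤ : ℕ∞) fun z => Υ t z i :=
    (hΥi i).comp (contDiff_const.prodMk contDiff_id)
  have htop : (1 : WithTop ℕ∞) ≤ ((⊤ : ℕ∞) : WithTop ℕ∞) := by exact_mod_cast le_top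
  have htop2 : (2 : WithTop ℕ∞) ≤ ((⊤ : ℕ∞) : WithTop ℕ∞) :=
    WithTop.coe_le_coe.2 (le_top : (2 : ℕ∞) ≤ ⊤)
  have hG : ContDiff ℝ 1 fun x : ℝ × (ℝ × ℝ) => ∑ i, conj (Υ x.1 x.2 i) * Υ x.1 x.2 i :=
    .sum fun i _ => ((Complex.conjCLE.contDiff.comp (hΥi i)).mul (hΥi i)).of_le htop
  have hA1 (v : ℝ × ℝ) (i j : Fin n) : ContDiff ℝ 1 fun z => fderiv ℝ (fun w => A w i j) z v :=
    (((hA i j).of_le htop2).fderiv_right (m := 1) (by norm_num)).clm_apply contDiff_const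
  let D (v z : ℝ × ℝ) : Matrix (Fin n) (Fin n) ℂ :=
    Matrix.of fun i j => fderiv ℝ (fun w => A w i j) z v
  have hD1 (v : ℝ × ℝ) (i j : Fin n) : ContDiff ℝ 1 fun z => D v z i j := hA1 v i j
  have hDh (v z : ℝ × ℝ) : (D v z).IsHermitian := isHermitian_fderiv_apply hAh z v
  have hdq (z : ℝ × ℝ) : dqM A z = D (1, 0) z := by
    ext i j
    exact deriv_slice_fst ((hA i j).differentiable (by simp) z)
  have hdp (z : ℝ × ℝ) : dpM A z = D (0, 1) z := by
    ext i j
    exact deriv_slice_snd ((hA i j).differentiable (by simp) z)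
  let U (t : ℝ) (v z : ℝ × ℝ) : ℂ := ∑ i, conj (Υ t z i) * (D v z).mulVec (Υ t z) i
  have hU (t : ℝ) (v : ℝ × ℝ) : ContDiff ℝ 1 (U t v) :=
    contDiff_hermitian_form (hD1 v) fun i => (hY t i).of_le htop
  have hUc (t : ℝ) (v : ℝ × ℝ) : HasCompactSupport (U t v) :=
    .intro hK fun z hz => by simp [U, hsupp t z hz]
  have hdiv (t : ℝ) (z : ℝ × ℝ) :
      deriv (fun s => ∑ i, conj (Υ s z i) * Υ s z i) t =
        fderiv ℝ (U t (1, 0)) z (0, 1) - fderiv ℝ (U t (0, 1)) z (1, 0) := by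
    have hYt (i : Fin n) : HasDerivAt (fun s => Υ s z i) (deriv (fun s => Υ s z i) t) t := by
      have : ContDiff ℝ (⊤ : ℕ∞) fun s => Υ s z i := (hΥi i).comp (contDiff_id.prodMk contDiff_const)
      exact (this.differentiable (by simp) t).hasDerivAt
    have h1 : HasDerivAt (fun s => ∑ i, conj (Υ s z i) * Υ s z i)
        (∑ i, (conj (deriv (fun s => Υ s z i) t) * Υ t z i
          + conj (Υ t z i) * deriv (fun s => Υ s z i) t)) t :=
      .fun_sum fun i _ => (hYt i).star.mul (hYt i)
    have hM : ((z.2 : ℂ) • dpM A z - A z).IsHermitian := by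
      rw [hdp]
      refine .sub ?_ (hAh z)
      rw [IsHermitian, conjTranspose_smul, (hDh _ z).eq]
      simp
    have hq : dqV (Υ t) z = fun i => fderiv ℝ (fun w => Υ t w i) z (1, 0) :=
      funext fun i => deriv_slice_fst ((hY t i).differentiable (by simp) z)
    have hp : dpV (Υ t) z = fun i => fderiv ℝ (fun w => Υ t w i) z (0, 1) :=
      funext fun i => deriv_slice_snd ((hY t i).differentiable (by simp) z)
    have hcomm : (Matrix.of fun i j => fderiv ℝ (fun w => D (1, 0) w i j) z (0, 1)) =
        Matrix.of fun i j => fderiv ℝ (fun w => D (0, 1) w i j) z (1, 0) := by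
      ext i j
      exact fderiv_fderiv_apply_comm ((hA i j).of_le htop2) z _ _
    have hUd (v w : ℝ × ℝ) := fderiv_hermitian_form (B := D v) (y := Υ t) (z := z)
      (fun i j => (hD1 v i j).differentiable one_ne_zero z)
      (fun i => (hY t i).differentiable (by simp) z) w
    rw [h1.deriv, sum_conj_mul_evolution hℏ.ne' (hdq z ▸ hDh _ z) (hdp z ▸ hDh _ z) hM
      (hQCWE t z), hUd, hUd, hcomm, hdq, hdp, hq, hp]
    ring
  have hderiv (t : ℝ) : HasDerivAt (fun s => ∫ z, ∑ i, conj (Υ s z i) * Υ s z i) 0 t := by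
    have hint (v w : ℝ × ℝ) : Integrable fun z => fderiv ℝ (U t v) z w :=
      (((hU t v).continuous_fderiv one_ne_zero).clm_apply
        continuous_const).integrable_of_hasCompactSupport ((hUc t v).fderiv_apply ℝ w)
    have h := hasDerivAt_integral_of_support_subset_compact
      (G := fun t z => ∑ i, conj (Υ t z i) * Υ t z i) hG hK
      (fun t z hz => by simp [hsupp t z hz]) t
    simpa only [hdiv, integral_sub (hint _ _) (hint _ _),
      integral_fderiv_apply_eq_zero (hU t _) (hUc t _), sub_zero] using h
  intro t₁ t₂
  have h := is_const_of_deriv_eq_zero (fun t => (hderiv t).differentiableAt)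
    (fun t => (hderiv t).deriv) t₁ t₂
  simp only [← Complex.normSq_eq_conj_mul_self, ← Complex.ofReal_sum] at h
  rw [integral_complex_ofReal, integral_complex_ofReal] at h
  exact Complex.ofReal_injective h
end

section
/- Let H : ℝ² → ℝ be smooth and let S : ℝ × ℝ² → ℝ be smooth and satisfy the phase-space Hamilton–Jacobi equation ∂ₜS = {H, S} + p ∂_p H − H. Let X = (X¹, X²) := (∂_p H, −∂_q H) be the Hamiltonian vector field and define the 1-form components α₁ := ∂_q S − p and α₂ := ∂_p S (the coordinates of dS − θ, θ = p dq). Then the 1-form dS − θ is advected, (∂ₜ + £_{X_H})(dS − θ) = 0; in coordinates, for i = 1, 2 and all (t,q,p): ∂ₜαᵢ + X¹ ∂_q αᵢ + X² ∂_p αᵢ + α₁ ∂ᵢ X¹ + α₂ ∂ᵢ X² = 0, where ∂₁ = ∂_q and ∂₂ = ∂_p. -/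
section DirectionalDerivative

variable {E : Type*} [NormedAddCommGroup E] [NormedSpace ℝ E] {F : E → ℝ}

theorem ContDiff.fderiv_apply_const (hF : ContDiff ℝ (⊤ : ℕ∞) F) (v : E) :
    ContDiff ℝ (⊤ : ℕ∞) (fun x => fderiv ℝ F x v) :=
  (hF.fderiv_right (m := (⊤ : ℕ∞)) (by simp)).clm_apply contDiff_const

theorem ContDiff.differentiable_of_smooth (hF : ContDiff ℝ (⊤ : ℕ∞) F) : Differentiable ℝ F :=
  hF.differentiable (by simp)

theorem ContDiff.fderiv_fderiv_comm (hF : ContDiff ℝ (⊤ : ℕ∞) F) (v w x : E) :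
    fderiv ℝ (fun y => fderiv ℝ F y v) x w = fderiv ℝ (fun y => fderiv ℝ F y w) x v := by
  have hd : DifferentiableAt ℝ (fderiv ℝ F) x :=
    (hF.fderiv_right (m := (⊤ : ℕ∞)) (by simp)).differentiable (by simp) x
  have hsymm : IsSymmSndFDerivAt ℝ F x :=
    hF.contDiffAt.isSymmSndFDerivAt (by
      rw [minSmoothness_of_isRCLikeNormedField]
      exact WithTop.coe_le_coe.2 (le_top : (2 : ℕ∞) ≤ ⊤))
  have key (u : E) : fderiv ℝ (fun y => fderiv ℝ F y u) x
      = (fderiv ℝ (fderiv ℝ F) x).flip u := by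
    rw [fderiv_clm_apply hd (differentiableAt_const u)]
    simp
  simp only [key, ContinuousLinearMap.flip_apply]
  exact hsymm w v

end DirectionalDerivative

theorem hasDerivAt_comp_fst_slice {f : ℝ × ℝ → ℝ} (hf : Differentiable ℝ f) (z : ℝ × ℝ) :
    HasDerivAt (fun q : ℝ => f (q, z.2)) (fderiv ℝ f z (1, 0)) z.1 :=
  (hf z).hasFDerivAt.comp_hasDerivAt z.1
    ((hasDerivAt_id z.1).prodMk (hasDerivAt_const z.1 z.2))

theorem hasDerivAt_comp_snd_slice {f : ℝ × ℝ → ℝ} (hf : Differentiable ℝ f) (z : ℝ × ℝ) :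
    HasDerivAt (fun p : ℝ => f (z.1, p)) (fderiv ℝ f z (0, 1)) z.2 :=
  (hf z).hasFDerivAt.comp_hasDerivAt z.2
    ((hasDerivAt_const z.2 z.1).prodMk (hasDerivAt_id z.2))

theorem dqR_eq_fderiv {f : ℝ × ℝ → ℝ} (hf : Differentiable ℝ f) :
    dqR f = fun z => fderiv ℝ f z (1, 0) :=
  funext fun z => (hasDerivAt_comp_fst_slice hf z).deriv

theorem dpR_eq_fderiv {f : ℝ × ℝ → ℝ} (hf : Differentiable ℝ f) :
    dpR f = fun z => fderiv ℝ f z (0, 1) :=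
  funext fun z => (hasDerivAt_comp_snd_slice hf z).deriv

theorem hasDerivAt_dqR {f : ℝ × ℝ → ℝ} (hf : ContDiff ℝ (⊤ : ℕ∞) f) (z : ℝ × ℝ) :
    HasDerivAt (fun q : ℝ => f (q, z.2)) (dqR f z) z.1 :=
  (hasDerivAt_comp_fst_slice hf.differentiable_of_smooth z).differentiableAt.hasDerivAt

theorem hasDerivAt_dpR {f : ℝ × ℝ → ℝ} (hf : ContDiff ℝ (⊤ : ℕ∞) f) (z : ℝ × ℝ) :
    HasDerivAt (fun p : ℝ => f (z.1, p)) (dpR f z) z.2 :=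
  (hasDerivAt_comp_snd_slice hf.differentiable_of_smooth z).differentiableAt.hasDerivAt

theorem ContDiff.dqR {f : ℝ × ℝ → ℝ} (hf : ContDiff ℝ (⊤ : ℕ∞) f) :
    ContDiff ℝ (⊤ : ℕ∞) (dqR f) := by
  rw [dqR_eq_fderiv hf.differentiable_of_smooth]
  exact hf.fderiv_apply_const _

theorem ContDiff.dpR {f : ℝ × ℝ → ℝ} (hf : ContDiff ℝ (⊤ : ℕ∞) f) :
    ContDiff ℝ (⊤ : ℕ∞) (dpR f) := by
  rw [dpR_eq_fderiv hf.differentiable_of_smooth]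
  exact hf.fderiv_apply_const _

theorem dpR_dqR_comm {f : ℝ × ℝ → ℝ} (hf : ContDiff ℝ (⊤ : ℕ∞) f) (z : ℝ × ℝ) :
    dpR (dqR f) z = dqR (dpR f) z := by
  rw [dpR_eq_fderiv hf.dqR.differentiable_of_smooth, dqR_eq_fderiv hf.dpR.differentiable_of_smooth,
    dqR_eq_fderiv hf.differentiable_of_smooth, dpR_eq_fderiv hf.differentiable_of_smooth]
  exact hf.fderiv_fderiv_comm _ _ _

section TimeDependent

variable {S : ℝ → ℝ × ℝ → ℝ}

theorem hasDerivAt_time {F : ℝ × (ℝ × ℝ) → ℝ} (hF : Differentiable ℝ F) (t : ℝ) (z : ℝ × ℝ) :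
    HasDerivAt (fun s => F (s, z)) (fderiv ℝ F (t, z) (1, 0)) t :=
  (hF (t, z)).hasFDerivAt.comp_hasDerivAt t ((hasDerivAt_id t).prodMk (hasDerivAt_const t z))

theorem dqR_time_slice {F : ℝ × (ℝ × ℝ) → ℝ} (hF : Differentiable ℝ F) (t : ℝ) (z : ℝ × ℝ) :
    dqR (fun w => F (t, w)) z = fderiv ℝ F (t, z) (0, (1, 0)) :=
  ((hF (t, z)).hasFDerivAt.comp_hasDerivAt z.1 ((hasDerivAt_const z.1 t).prodMk
    ((hasDerivAt_id z.1).prodMk (hasDerivAt_const z.1 z.2)))).deriv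

theorem dpR_time_slice {F : ℝ × (ℝ × ℝ) → ℝ} (hF : Differentiable ℝ F) (t : ℝ) (z : ℝ × ℝ) :
    dpR (fun w => F (t, w)) z = fderiv ℝ F (t, z) (0, (0, 1)) :=
  ((hF (t, z)).hasFDerivAt.comp_hasDerivAt z.2 ((hasDerivAt_const z.2 t).prodMk
    ((hasDerivAt_const z.2 z.1).prodMk (hasDerivAt_id z.2)))).deriv

theorem deriv_dqR_comm (hS : ContDiff ℝ (⊤ : ℕ∞) (fun tz : ℝ × (ℝ × ℝ) => S tz.1 tz.2))
    (t : ℝ) (z : ℝ × ℝ) :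
    deriv (fun s => dqR (S s) z) t = dqR (fun w => deriv (fun s => S s w) t) z := by
  have hd := hS.differentiable_of_smooth
  have hL : (fun s => dqR (S s) z) = fun s => _ := funext fun s => dqR_time_slice hd s z
  have hR : (fun w => deriv (fun s => S s w) t) = fun w => _ :=
    funext fun w => (hasDerivAt_time hd t w).deriv
  rw [hL, hR, dqR_time_slice (hS.fderiv_apply_const _).differentiable_of_smooth]
  rw [(hasDerivAt_time (hS.fderiv_apply_const _).differentiable_of_smooth t z).deriv]
  exact hS.fderiv_fderiv_comm _ _ _

theorem deriv_dpR_comm (hS : ContDiff ℝ (⊤ : ℕ∞) (fun tz : ℝ × (ℝ × ℝ) => S tz.1 tz.2))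
    (t : ℝ) (z : ℝ × ℝ) :
    deriv (fun s => dpR (S s) z) t = dpR (fun w => deriv (fun s => S s w) t) z := by
  have hd := hS.differentiable_of_smooth
  have hL : (fun s => dpR (S s) z) = fun s => _ := funext fun s => dpR_time_slice hd s z
  have hR : (fun w => deriv (fun s => S s w) t) = fun w => _ :=
    funext fun w => (hasDerivAt_time hd t w).deriv
  rw [hL, hR, dpR_time_slice (hS.fderiv_apply_const _).differentiable_of_smooth]
  rw [(hasDerivAt_time (hS.fderiv_apply_const _).differentiable_of_smooth t z).deriv]
  exact hS.fderiv_fderiv_comm _ _ _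

end TimeDependent

theorem dqR_hamiltonJacobi {H f : ℝ × ℝ → ℝ} (hH : ContDiff ℝ (⊤ : ℕ∞) H)
    (hf : ContDiff ℝ (⊤ : ℕ∞) f) (z : ℝ × ℝ) :
    dqR (fun w => pbR H f w + w.2 * dpR H w - H w) z
      = dqR (dqR H) z * dpR f z + dqR H z * dqR (dpR f) z
        - (dqR (dpR H) z * dqR f z + dpR H z * dqR (dqR f) z)
        + z.2 * dqR (dpR H) z - dqR H z :=
  ((((hasDerivAt_dqR hH.dqR z).mul (hasDerivAt_dqR hf.dpR z)).sub
    ((hasDerivAt_dqR hH.dpR z).mul (hasDerivAt_dqR hf.dqR z))).add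
    ((hasDerivAt_dqR hH.dpR z).const_mul z.2)).sub (hasDerivAt_dqR hH z) |>.deriv

theorem dpR_hamiltonJacobi {H f : ℝ × ℝ → ℝ} (hH : ContDiff ℝ (⊤ : ℕ∞) H)
    (hf : ContDiff ℝ (⊤ : ℕ∞) f) (z : ℝ × ℝ) :
    dpR (fun w => pbR H f w + w.2 * dpR H w - H w) z
      = dpR (dqR H) z * dpR f z + dqR H z * dpR (dpR f) z
        - (dpR (dpR H) z * dqR f z + dpR H z * dpR (dqR f) z)
        + (1 * dpR H z + z.2 * dpR (dpR H) z) - dpR H z :=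
  ((((hasDerivAt_dpR hH.dqR z).mul (hasDerivAt_dpR hf.dpR z)).sub
    ((hasDerivAt_dpR hH.dpR z).mul (hasDerivAt_dpR hf.dqR z))).add
    ((hasDerivAt_id z.2).mul (hasDerivAt_dpR hH.dpR z))).sub (hasDerivAt_dpR hH z) |>.deriv

/-- If `S` satisfies the phase-space Hamilton–Jacobi equation
`∂ₜS = {H, S} + p ∂_p H − H`, then the 1-form `dS − θ` (with components
`α₁ = ∂_q S − p`, `α₂ = ∂_p S`) is advected by the Hamiltonian vector field
`X = (∂_p H, −∂_q H)`: `(∂ₜ + £_X)(dS − θ) = 0` componentwise. -/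
theorem hamilton_jacobi_advects_one_form
    (H : ℝ × ℝ → ℝ) (hH : ContDiff ℝ (⊤ : ℕ∞) H)
    (S : ℝ → ℝ × ℝ → ℝ)
    (hS : ContDiff ℝ (⊤ : ℕ∞) (fun tz : ℝ × (ℝ × ℝ) => S tz.1 tz.2))
    (hHJ : ∀ (t : ℝ) (z : ℝ × ℝ),
      deriv (fun s => S s z) t = pbR H (S t) z + z.2 * dpR H z - H z)
    (X₁ X₂ : ℝ × ℝ → ℝ) (hX₁ : X₁ = fun z => dpR H z) (hX₂ : X₂ = fun z => -dqR H z)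
    (α₁ α₂ : ℝ → ℝ × ℝ → ℝ)
    (hα₁ : ∀ t z, α₁ t z = dqR (S t) z - z.2)
    (hα₂ : ∀ t z, α₂ t z = dpR (S t) z) :
    (∀ (t : ℝ) (z : ℝ × ℝ),
        deriv (fun s => α₁ s z) t
          + X₁ z * dqR (α₁ t) z + X₂ z * dpR (α₁ t) z
          + α₁ t z * dqR X₁ z + α₂ t z * dqR X₂ z = 0)
    ∧ (∀ (t : ℝ) (z : ℝ × ℝ),
        deriv (fun s => α₂ s z) t
          + X₁ z * dqR (α₂ t) z + X₂ z * dpR (α₂ t) z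
          + α₁ t z * dpR X₁ z + α₂ t z * dpR X₂ z = 0) := by
  have hSt (t : ℝ) : ContDiff ℝ (⊤ : ℕ∞) (S t) :=
    hS.comp (contDiff_const.prodMk contDiff_id : ContDiff ℝ _ fun z : ℝ × ℝ => (t, z))
  have hHJ' (t : ℝ) : (fun w => deriv (fun s => S s w) t)
      = fun w => pbR H (S t) w + w.2 * dpR H w - H w := funext (hHJ t)
  obtain rfl : α₁ = fun t z => dqR (S t) z - z.2 := funext₂ hα₁
  obtain rfl : α₂ = fun t z => dpR (S t) z := funext₂ hα₂
  subst hX₁ hX₂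
  have hneg_q (z : ℝ × ℝ) : dqR (fun w => -dqR H w) z = -dqR (dqR H) z :=
    (hasDerivAt_dqR hH.dqR z).neg.deriv
  have hneg_p (z : ℝ × ℝ) : dpR (fun w => -dqR H w) z = -dpR (dqR H) z :=
    (hasDerivAt_dpR hH.dqR z).neg.deriv
  have hα_q (t : ℝ) (z : ℝ × ℝ) : dqR (fun w => dqR (S t) w - w.2) z = dqR (dqR (S t)) z :=
    ((hasDerivAt_dqR (hSt t).dqR z).sub_const z.2).deriv
  have hα_p (t : ℝ) (z : ℝ × ℝ) :
      dpR (fun w => dqR (S t) w - w.2) z = dpR (dqR (S t)) z - 1 :=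
    ((hasDerivAt_dpR (hSt t).dqR z).sub (hasDerivAt_id z.2)).deriv
  refine ⟨fun t z => ?_, fun t z => ?_⟩
  · simp only [deriv_sub_const_fun]
    rw [deriv_dqR_comm hS, hHJ', dqR_hamiltonJacobi hH (hSt t), hneg_q, hα_q, hα_p,
      dpR_dqR_comm (hSt t)]
    ring
  · beta_reduce
    rw [deriv_dpR_comm hS, hHJ', dpR_hamiltonJacobi hH (hSt t), hneg_p,
      dpR_dqR_comm (hSt t)]
    ring
end
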